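/- Every full-rank lattice in ℝ⁴ with the Euclidean norm is standard: it has a ℤ-basis b₁, b₂, b₃, b₄ with ‖bᵢ‖₂ = λᵢ for i = 1, …, 4. -/

import Mathlib

/-- The i-th successive minimum of a lattice Λ ⊆ ℝⁿ (Euclidean norm). -/
noncomputable def succMin (n : ℕ) (Λ : Set (EuclideanSpace ℝ (Fin n))) (i : ℕ) : ℝ :=
  sInf {r : ℝ | i ≤ Module.finrank ℝ (Submodule.span ℝ (Λ ∩ Metric.closedBall 0 r))}

open Submodule in
/-- Rounding real coefficients one at a time: some integral combination of the `c i` is close to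
any given real combination, relative to any offset `e`. -/
lemma exists_span_int_norm_sq_le {E ι : Type*} [NormedAddCommGroup E] [InnerProductSpace ℝ E]
    (c : ι → E) (s : Finset ι) : ∀ e : E, ∀ y ∈ span ℝ (c '' s), ∃ z ∈ span ℤ (c '' s),
      ‖e + y - z‖ ^ 2 ≤ ‖e‖ ^ 2 + (∑ i ∈ s, ‖c i‖ ^ 2) / 4 := by
  classical
  induction s using Finset.induction_on with
  | empty =>
    intro e y hy
    refine ⟨0, zero_mem _, ?_⟩
    simp_all
  | insert i s hi ih =>
    intro e y hy
    rw [Finset.coe_insert, Set.image_insert_eq] at hy ⊢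
    obtain ⟨t, y', hy', rfl⟩ := mem_span_insert.1 hy
    have key : ∃ n : ℤ, ‖e + (t - n) • c i‖ ^ 2 ≤ ‖e‖ ^ 2 + ‖c i‖ ^ 2 / 4 := by
      have expand (r : ℝ) : ‖e + r • c i‖ ^ 2 =
          ‖e‖ ^ 2 + 2 * r * inner ℝ e (c i) + r ^ 2 * ‖c i‖ ^ 2 := by
        rw [norm_add_sq_real, inner_smul_right, norm_smul, mul_pow, Real.norm_eq_abs, sq_abs]
        ring
      have h0 := Int.fract_nonneg t
      have h1 := Int.fract_lt_one t
      have hf : t - ⌊t⌋ = Int.fract t := rfl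
      generalize Int.fract t = f at *
      by_contra! h
      have hlo := h ⌊t⌋
      have hhi := h (⌊t⌋ + 1)
      rw [expand] at hlo hhi
      push_cast at hhi
      rw [← sub_sub, hf] at hhi
      rw [hf] at hlo
      have hc := sq_nonneg ‖c i‖
      nlinarith [mul_pos (sub_pos.2 h1) (sub_pos.2 hlo), mul_nonneg h0 (sub_pos.2 hhi).le,
        mul_nonneg hc (sq_nonneg (f - 1 / 2))]
    obtain ⟨n, hn⟩ := key
    obtain ⟨z, hz, hle⟩ := ih (e + (t - n) • c i) y' hy'
    refine ⟨n • c i + z, mem_span_insert.2 ⟨n, z, hz, rfl⟩, ?_⟩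
    rw [Finset.sum_insert hi]
    have : e + (t • c i + y') - (n • c i + z) = e + (t - n) • c i + y' - z := by
      rw [sub_smul, Int.cast_smul_eq_zsmul]; abel
    rw [this]
    linarith

/-- A shortest vector of `L` outside `V` can be replaced by an equally short one which, together
with `M = L ∩ V`, generates all of `L ∩ (V + ℝ w)`, provided `V / M` has small covering radius. -/
lemma exists_primitive_of_minimal {E : Type*} [NormedAddCommGroup E] [InnerProductSpace ℝ E]
    (L M : Submodule ℤ E) (V : Submodule ℝ E) (D : ℝ)
    (hfin : ∀ R : ℝ, (Metric.closedBall (0 : E) R ∩ L).Finite)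
    (hML : M ≤ L) (hMV : ∀ x ∈ M, x ∈ V) (hLV : ∀ x ∈ L, x ∈ V → x ∈ M)
    (hround : ∀ e : E, ∀ y ∈ V, ∃ z ∈ M, ‖e + y - z‖ ^ 2 ≤ ‖e‖ ^ 2 + D)
    (v : E) (hv : v ∈ L) (hvV : v ∉ V) (hD : D ≤ 3 / 4 * ‖v‖ ^ 2) :
    ∃ w ∈ L, w ∉ V ∧ ‖w‖ ≤ ‖v‖ ∧
      ∀ x ∈ L, ∀ s : ℝ, x - s • w ∈ V → ∃ n : ℤ, x - n • w ∈ M := by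
  let H : AddSubgroup ℝ :=
    { carrier := {t | ∃ y ∈ V, y + t • v ∈ L}
      zero_mem' := ⟨0, zero_mem _, by simp⟩
      add_mem' := by
        rintro s t ⟨y, hy, hs⟩ ⟨z, hz, ht⟩
        refine ⟨y + z, add_mem hy hz, ?_⟩
        have := add_mem hs ht
        rwa [add_add_add_comm, ← add_smul] at this
      neg_mem' := by
        rintro s ⟨y, hy, hs⟩
        refine ⟨-y, neg_mem hy, ?_⟩
        have := neg_mem hs
        rwa [neg_add, ← neg_smul] at this }
  have one_mem : (1 : ℝ) ∈ H := ⟨0, zero_mem _, by simpa using hv⟩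
  have short (t : ℝ) (ht : t ∈ H) :
      ∃ x ∈ L, x - t • v ∈ V ∧ ‖x‖ ^ 2 ≤ t ^ 2 * ‖v‖ ^ 2 + D := by
    obtain ⟨y, hy, hL⟩ := ht
    obtain ⟨z, hz, hle⟩ := hround (t • v) y hy
    refine ⟨t • v + y - z, sub_mem (by rwa [add_comm]) (hML hz), ?_, ?_⟩
    · have : t • v + y - z - t • v = y - z := by abel
      rw [this]
      exact sub_mem hy (hMV z hz)
    · rwa [norm_smul, mul_pow, Real.norm_eq_abs, sq_abs] at hle
  have hT : {t | t ∈ H ∧ 0 < t ∧ t ≤ 1}.Finite := by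
    choose! f hfL hfV hf using short
    refine Set.Finite.of_injOn (f := f) (t := Metric.closedBall (0 : E) (2 * ‖v‖) ∩ L)
      ?_ ?_ (hfin _)
    · rintro t ⟨ht, h0, h1⟩
      refine ⟨?_, hfL t ht⟩
      rw [mem_closedBall_zero_iff]
      refine le_of_sq_le_sq ?_ (by positivity)
      have := hf t ht
      nlinarith [sq_nonneg ‖v‖, mul_nonneg (sq_nonneg ‖v‖) (by nlinarith : 0 ≤ 1 - t ^ 2)]
    · rintro s ⟨hs, -⟩ t ⟨ht, -⟩ hst
      by_contra hne
      have h := sub_mem (hfV t ht) (hfV s hs)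
      rw [hst, sub_sub_sub_cancel_left, ← sub_smul] at h
      exact hvV ((V.smul_mem_iff (sub_ne_zero.2 hne)).1 h)
  obtain ⟨a, ⟨haH, ha0, ha1⟩, hmin⟩ :=
    Set.exists_min_image _ id hT ⟨1, one_mem, one_pos, le_rfl⟩
  have hleast : IsLeast {g : ℝ | g ∈ H ∧ 0 < g} a := by
    refine ⟨⟨haH, ha0⟩, fun t ht => ?_⟩
    rcases le_total t 1 with h | h
    · exact hmin t ⟨ht.1, ht.2, h⟩
    · exact ha1.trans h
  have hcyc (t : ℝ) (ht : t ∈ H) : ∃ n : ℤ, n * a = t := by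
    rw [AddSubgroup.cyclic_of_min hleast, AddSubgroup.mem_closure_singleton] at ht
    simpa using ht
  have hw : ∃ w ∈ L, w - a • v ∈ V ∧ ‖w‖ ≤ ‖v‖ := by
    obtain ⟨m, hm⟩ := hcyc 1 one_mem
    rcases le_or_gt m 1 with h | h
    · have : a = 1 := by
        have : (m : ℝ) ≤ 1 := by exact_mod_cast h
        nlinarith
      exact ⟨v, hv, by simp [this], le_rfl⟩
    · obtain ⟨w, hwL, hwV, hle⟩ := short a haH
      refine ⟨w, hwL, hwV, le_of_sq_le_sq ?_ (norm_nonneg _)⟩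
      have h2 : (2 : ℝ) ≤ m := by exact_mod_cast h
      have ha2 : a ≤ 1 / 2 := by nlinarith
      nlinarith [mul_nonneg (sq_nonneg ‖v‖) (by nlinarith : 0 ≤ 1 / 4 - a ^ 2)]
  obtain ⟨w, hwL, hwV, hle⟩ := hw
  refine ⟨w, hwL, fun h => hvV ?_, hle, fun x hx s hs => ?_⟩
  · have := sub_mem h hwV
    rw [sub_sub_cancel] at this
    exact (V.smul_mem_iff ha0.ne').1 this
  · have hsa : s * a ∈ H := by
      refine ⟨x - (s * a) • v, ?_, by simpa using hx⟩
      have := add_mem hs (V.smul_mem s hwV)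
      rwa [smul_sub, smul_smul, sub_add_sub_cancel] at this
    obtain ⟨n, hn⟩ := hcyc _ hsa
    obtain rfl := mul_right_cancel₀ ha0.ne' hn
    rw [Int.cast_smul_eq_zsmul] at hs
    exact ⟨n, hLV _ (sub_mem hx (L.smul_mem n hwL)) hs⟩

/-- The first `k` terms of `c` lie in `L`, and each is a shortest vector of `L` outside the span of
its predecessors. -/
def IsGreedy {E : Type*} [NormedAddCommGroup E] [InnerProductSpace ℝ E]
    (L : Submodule ℤ E) (c : ℕ → E) (k : ℕ) : Prop :=
  ∀ i < k, c i ∈ L ∧ c i ∉ Submodule.span ℝ (c '' Set.Iio i) ∧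
    ∀ x ∈ L, x ∉ Submodule.span ℝ (c '' Set.Iio i) → ‖c i‖ ≤ ‖x‖

section Greedy

variable {E : Type*} [NormedAddCommGroup E] [InnerProductSpace ℝ E] {L : Submodule ℤ E}
  {c : ℕ → E} {k : ℕ}

lemma range_fin_eq_image_Iio {α : Type*} (c : ℕ → α) (k : ℕ) :
    Set.range (fun i : Fin k => c i) = c '' Set.Iio k := by
  ext x
  simp [Fin.exists_iff]

lemma IsGreedy.linearIndependent (h : IsGreedy L c k) :
    LinearIndependent ℝ (fun i : Fin k => c i) := by
  induction k with
  | zero => exact linearIndependent_empty_type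
  | succ k ih =>
    rw [linearIndependent_finSucc']
    refine ⟨ih fun i hi => h i (by omega), ?_⟩
    have : Set.range (Fin.init fun i : Fin (k + 1) => c i) = c '' Set.Iio k :=
      range_fin_eq_image_Iio c k
    rw [this]
    exact (h k (by omega)).2.1

lemma IsGreedy.finrank_span (h : IsGreedy L c k) :
    Module.finrank ℝ (Submodule.span ℝ (c '' Set.Iio k)) = k := by
  rw [← range_fin_eq_image_Iio, finrank_span_eq_card h.linearIndependent, Fintype.card_fin]

lemma IsGreedy.norm_le (h : IsGreedy L c k) {i j : ℕ} (hij : i ≤ j) (hj : j < k) :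
    ‖c i‖ ≤ ‖c j‖ :=
  (h i (by omega)).2.2 _ (h j hj).1 fun hmem => (h j hj).2.1 <|
    Submodule.span_mono (Set.image_mono (Set.Iio_subset_Iio hij)) hmem

/-- Greedy integral bases can be extended as long as they have at most three members. -/
lemma IsGreedy.exists_succ (hfin : ∀ R : ℝ, (Metric.closedBall (0 : E) R ∩ L).Finite)
    (h : IsGreedy L c k)
    (hprim : ∀ x ∈ L, x ∈ Submodule.span ℝ (c '' Set.Iio k) →
      x ∈ Submodule.span ℤ (c '' Set.Iio k))
    (hk : k ≤ 3) (hne : ∃ x ∈ L, x ∉ Submodule.span ℝ (c '' Set.Iio k)) :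
    ∃ c' : ℕ → E, IsGreedy L c' (k + 1) ∧
      ∀ x ∈ L, x ∈ Submodule.span ℝ (c' '' Set.Iio (k + 1)) →
        x ∈ Submodule.span ℤ (c' '' Set.Iio (k + 1)) := by
  obtain ⟨v, ⟨hvL, hvV⟩, hmin⟩ : ∃ v, (v ∈ L ∧ v ∉ Submodule.span ℝ (c '' Set.Iio k)) ∧
      ∀ x ∈ L, x ∉ Submodule.span ℝ (c '' Set.Iio k) → ‖v‖ ≤ ‖x‖ := by
    obtain ⟨u, huL, huV⟩ := hne
    obtain ⟨v, ⟨⟨hv, hvL⟩, hvV⟩, hmin⟩ := Set.exists_min_image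
      ((Metric.closedBall (0 : E) ‖u‖ ∩ L) \ Submodule.span ℝ (c '' Set.Iio k)) norm
      ((hfin ‖u‖).subset Set.sdiff_subset) ⟨u, ⟨by simp, huL⟩, huV⟩
    refine ⟨v, ⟨hvL, hvV⟩, fun x hx hxV => ?_⟩
    rcases le_total ‖x‖ ‖u‖ with hxu | hxu
    · exact hmin x ⟨⟨by simpa using hxu, hx⟩, hxV⟩
    · exact (by simpa using hv : ‖v‖ ≤ ‖u‖).trans hxu
  have hround := exists_span_int_norm_sq_le c (Finset.range k)
  rw [Finset.coe_range] at hround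
  have hD : (∑ i ∈ Finset.range k, ‖c i‖ ^ 2) / 4 ≤ 3 / 4 * ‖v‖ ^ 2 := by
    have hsum : ∑ i ∈ Finset.range k, ‖c i‖ ^ 2 ≤ (Finset.range k).card • ‖v‖ ^ 2 := by
      refine Finset.sum_le_card_nsmul _ _ _ fun i hi => ?_
      have hi := Finset.mem_range.1 hi
      have : ‖c i‖ ≤ ‖v‖ := (h i hi).2.2 v hvL fun hmem => hvV <|
        Submodule.span_mono (Set.image_mono (Set.Iio_subset_Iio hi.le)) hmem
      gcongr
    rw [Finset.card_range, nsmul_eq_mul] at hsum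
    have : (k : ℝ) ≤ 3 := by exact_mod_cast hk
    nlinarith [sq_nonneg ‖v‖]
  have hML : Submodule.span ℤ (c '' Set.Iio k) ≤ L := by
    rw [Submodule.span_le]
    rintro _ ⟨i, hi, rfl⟩
    exact (h i hi).1
  obtain ⟨w, hwL, hwV, hwv, hw⟩ := exists_primitive_of_minimal L _ _ _ hfin hML
    (fun x hx => Submodule.span_le_restrictScalars ℤ ℝ _ hx) hprim hround v hvL hvV hD
  have himage {i : ℕ} (hi : i ≤ k) : Function.update c k w '' Set.Iio i = c '' Set.Iio i :=
    Set.image_congr fun j hj => Function.update_of_ne (lt_of_lt_of_le hj hi).ne _ _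
  have hsucc : Function.update c k w '' Set.Iio (k + 1) = insert w (c '' Set.Iio k) := by
    have : Set.Iio (k + 1) = insert k (Set.Iio k) := by
      ext; simp
    rw [this, Set.image_insert_eq, himage le_rfl, Function.update_self]
  refine ⟨Function.update c k w, fun i hi => ?_, fun x hx hxV => ?_⟩
  · rw [himage (by omega : i ≤ k)]
    rcases (Nat.lt_succ_iff.1 hi).lt_or_eq with hik | rfl
    · rw [Function.update_of_ne hik.ne]
      exact h i hik
    · rw [Function.update_self]
      exact ⟨hwL, hwV, fun x hx hxV => hwv.trans (hmin x hx hxV)⟩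
  · rw [hsucc] at hxV ⊢
    obtain ⟨s, y, hy, rfl⟩ := Submodule.mem_span_insert.1 hxV
    obtain ⟨n, hn⟩ := hw _ hx s (by simpa using hy)
    exact Submodule.mem_span_insert.2 ⟨n, _, hn, by abel⟩

/-- A discrete subgroup spanning a space of dimension at least `k`, with `k ≤ 4`, contains a
greedy `k`-tuple which is a basis of a primitive sublattice. -/
lemma exists_isGreedy (hfin : ∀ R : ℝ, (Metric.closedBall (0 : E) R ∩ L).Finite)
    (hspan : Submodule.span ℝ (L : Set E) = ⊤) (k : ℕ) (hk : k ≤ 4)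
    (hkE : k ≤ Module.finrank ℝ E) :
    ∃ c : ℕ → E, IsGreedy L c k ∧ ∀ x ∈ L, x ∈ Submodule.span ℝ (c '' Set.Iio k) →
      x ∈ Submodule.span ℤ (c '' Set.Iio k) := by
  induction k with
  | zero => exact ⟨0, fun i hi => absurd hi (by omega), by simp⟩
  | succ k ih =>
    obtain ⟨c, hc, hprim⟩ := ih (by omega) (by omega)
    refine hc.exists_succ hfin hprim (by omega) ?_
    by_contra! hall
    have htop : Submodule.span ℝ (c '' Set.Iio k) = ⊤ :=
      top_le_iff.1 (hspan ▸ Submodule.span_le.2 hall)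
    have := hc.finrank_span
    rw [htop, finrank_top] at this
    omega

end Greedy

lemma IsGreedy.norm_eq_succMin {n k : ℕ} {L : Submodule ℤ (EuclideanSpace ℝ (Fin n))}
    {c : ℕ → EuclideanSpace ℝ (Fin n)} (h : IsGreedy L c k) {i : ℕ} (hi : i < k) :
    ‖c i‖ = succMin n L (i + 1) := by
  refine (IsLeast.csInf_eq ⟨?_, fun r hr => ?_⟩).symm
  · have hsub : c '' Set.Iio (i + 1) ⊆ ↑L ∩ Metric.closedBall 0 ‖c i‖ := by
      rintro _ ⟨j, hj, rfl⟩
      have hj := Nat.lt_succ_iff.1 hj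
      exact ⟨(h j (by omega)).1, by simpa using h.norm_le hj hi⟩
    have hi' : IsGreedy L c (i + 1) := fun j hj => h j (by omega)
    exact hi'.finrank_span.symm.le.trans (Submodule.finrank_mono (Submodule.span_mono hsub))
  · by_contra! hlt
    have hle : Submodule.span ℝ (↑L ∩ Metric.closedBall 0 r) ≤
        Submodule.span ℝ (c '' Set.Iio i) := by
      refine Submodule.span_le.2 fun x hx => ?_
      by_contra hxV
      have := (h i hi).2.2 x hx.1 hxV
      have hxr : ‖x‖ ≤ r := by simpa using hx.2
      linarith
    have hi' : IsGreedy L c i := fun j hj => h j (by omega)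
    have := hr.trans (Submodule.finrank_mono hle)
    rw [hi'.finrank_span] at this
    omega

/-- Every full-rank lattice in ℝ⁴ is standard: some ℤ-basis achieves the successive minima. -/
theorem stmt_11 (b : Fin 4 → EuclideanSpace ℝ (Fin 4)) (hli : LinearIndependent ℝ b) :
    ∃ c : Fin 4 → EuclideanSpace ℝ (Fin 4),
      LinearIndependent ℝ c ∧
      Submodule.span ℤ (Set.range c) = Submodule.span ℤ (Set.range b) ∧
      ∀ i : Fin 4, ‖c i‖ =
        succMin 4 ((Submodule.span ℤ (Set.range b) :
          Submodule ℤ (EuclideanSpace ℝ (Fin 4))) : Set _) (i + 1) := by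
  set L := Submodule.span ℤ (Set.range b)
  have hbtop : Submodule.span ℝ (Set.range b) = ⊤ :=
    hli.span_eq_top_of_card_eq_finrank (by simp)
  have hfin (R : ℝ) :
      (Metric.closedBall (0 : EuclideanSpace ℝ (Fin 4)) R ∩ L).Finite := by
    have := ZSpan.setFinite_inter (Module.Basis.mk hli hbtop.ge)
      (Metric.isBounded_closedBall (x := (0 : EuclideanSpace ℝ (Fin 4))) (r := R))
    rwa [Module.Basis.coe_mk] at this
  have hspan : Submodule.span ℝ (L : Set (EuclideanSpace ℝ (Fin 4))) = ⊤ :=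
    top_le_iff.1 (hbtop ▸ Submodule.span_mono Submodule.subset_span)
  obtain ⟨c, hc, hprim⟩ := exists_isGreedy hfin hspan 4 le_rfl (by simp)
  refine ⟨fun i => c i, hc.linearIndependent, ?_, fun i => hc.norm_eq_succMin i.2⟩
  have htop : Submodule.span ℝ (c '' Set.Iio 4) = ⊤ :=
    Submodule.eq_top_of_finrank_eq (by rw [hc.finrank_span]; simp)
  rw [range_fin_eq_image_Iio c 4]
  refine le_antisymm (Submodule.span_le.2 ?_) fun x hx => hprim x hx (htop ▸ Submodule.mem_top)
  rintro _ ⟨i, hi, rfl⟩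
  exact (hc i hi).1
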